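/- Let T > 0, and for i = 1,2,3 let ℓ_i ≥ 1, h_i > 0, and v_i ∈ C¹([0,ℓ_i]) with v₁(x) < 0 on [0,ℓ₁], v₂(x) > 0 on [0,ℓ₂], v₃(x) > 0 on [0,ℓ₃]. For each i let f_i ∈ C¹([0,ℓ_i]×[0,T]) with f₁(ℓ₁,0) = 0 and f_i(0,0) = 0 for i = 1,2,3, and let d ∈ C¹([0,T]) with d(0) = 0 and d'(0) = 0. Then there exists exactly one triple (w₁,w₂,w₃) with w_i ∈ C¹([0,ℓ_i]×[0,T]) such that: ∂_t w_i(x,t) + ∂_x(v_i(x) w_i(x,t)) = f_i(x,t) on [0,ℓ_i]×[0,T] and w_i(x,0) = 0 for all x ∈ [0,ℓ_i] (i = 1,2,3); w₁(ℓ₁,t) = 0 for all t ∈ [0,T]; and the weighted-average vertex conditions w_i(0,t) = (d(t) − v₁(0) h₁² w₁(0,t)) / (2 v_i(0) h_i²) hold for i = 2,3 and all t ∈ [0,T]. Moreover this solution satisfies the inhomogeneous Kirchhoff condition Σ_{i=1}^{3} v_i(0) h_i² w_i(0,t) = d(t) for all t ∈ [0,T]. -/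

import Mathlib

open Set

/-- `EdgeSol ℓ T v f w` says that `w` is a C¹ function on `[0,ℓ] × [0,T]` satisfying the
transport equation `∂ₜ w + ∂ₓ (v w) = f` (with `∂ₓ (v w) = v' w + v ∂ₓ w`) pointwise on
the closed rectangle, together with the zero initial condition `w(x,0) = 0`. -/
def EdgeSol (ℓ T : ℝ) (v : ℝ → ℝ) (f : ℝ → ℝ → ℝ) (w : ℝ → ℝ → ℝ) : Prop :=
  ContDiffOn ℝ 1 (fun p : ℝ × ℝ => w p.1 p.2) (Icc 0 ℓ ×ˢ Icc 0 T) ∧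
  (∀ x ∈ Icc 0 ℓ, ∀ t ∈ Icc 0 T,
    derivWithin (fun τ => w x τ) (Icc 0 T) t
      + (derivWithin v (Icc 0 ℓ) x * w x t + v x * derivWithin (fun y => w y t) (Icc 0 ℓ) x)
      = f x t) ∧
  (∀ x ∈ Icc 0 ℓ, w x 0 = 0)

/-- `GraphSolWeighted` collects the conditions of the paper's problem (3.30):
transport equations `∂ₜ wᵢ + ∂ₓ (vᵢ wᵢ) = fᵢ` with zero initial data, the homogeneous
Dirichlet condition at the inflow end `x = ℓ₁` of the first edge, and the weighted
incoming concentration average (3.31) as vertex condition for the outgoing edges. -/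
def GraphSolWeighted (ℓ₁ ℓ₂ ℓ₃ T : ℝ) (h₁ h₂ h₃ : ℝ) (v₁ v₂ v₃ : ℝ → ℝ)
    (f₁ f₂ f₃ : ℝ → ℝ → ℝ) (d : ℝ → ℝ) (w₁ w₂ w₃ : ℝ → ℝ → ℝ) : Prop :=
  EdgeSol ℓ₁ T v₁ f₁ w₁ ∧
  EdgeSol ℓ₂ T v₂ f₂ w₂ ∧
  EdgeSol ℓ₃ T v₃ f₃ w₃ ∧
  (∀ t ∈ Icc 0 T, w₁ ℓ₁ t = 0) ∧
  (∀ t ∈ Icc 0 T,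
    w₂ 0 t = (d t - v₁ 0 * h₁ ^ 2 * w₁ 0 t) / (2 * v₂ 0 * h₂ ^ 2) ∧
    w₃ 0 t = (d t - v₁ 0 * h₁ ^ 2 * w₁ 0 t) / (2 * v₃ 0 * h₃ ^ 2))

/-- Clamping a real number to `[0, a]`. -/
def clampIcc (a x : ℝ) : ℝ := max 0 (min x a)

lemma continuous_clampIcc (a : ℝ) : Continuous (clampIcc a) := by
  unfold clampIcc; fun_prop

lemma clampIcc_mem {a : ℝ} (ha : 0 ≤ a) (x : ℝ) : clampIcc a x ∈ Icc 0 a :=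
  ⟨le_max_left _ _, max_le ha (min_le_right _ _)⟩

lemma clampIcc_of_mem {a x : ℝ} (hx : x ∈ Icc 0 a) : clampIcc a x = x := by
  rw [clampIcc, min_eq_left hx.2, max_eq_right hx.1]

lemma clampIcc_of_nonpos {a x : ℝ} (ha : 0 ≤ a) (hx : x ≤ 0) : clampIcc a x = 0 := by
  rw [clampIcc, min_eq_left (hx.trans ha), max_eq_left hx]

lemma uniqueDiffOn_rect {a b : ℝ} (ha : 0 < a) (hb : 0 < b) :
    UniqueDiffOn ℝ (Icc 0 a ×ˢ Icc 0 b) :=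
  (uniqueDiffOn_Icc ha).prod (uniqueDiffOn_Icc hb)

lemma hasDerivWithinAt_rect_fst {ℓ T : ℝ} {w : ℝ → ℝ → ℝ}
    (hw : ContDiffOn ℝ 1 (fun p : ℝ × ℝ => w p.1 p.2) (Icc 0 ℓ ×ˢ Icc 0 T))
    {x t : ℝ} (hx : x ∈ Icc 0 ℓ) (ht : t ∈ Icc 0 T) :
    HasDerivWithinAt (fun y => w y t)
      (fderivWithin ℝ (fun p : ℝ × ℝ => w p.1 p.2) (Icc 0 ℓ ×ˢ Icc 0 T) (x, t) (1, 0))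
      (Icc 0 ℓ) x := by
  have h := ((hw.differentiableOn one_ne_zero) (x, t) ⟨hx, ht⟩).hasFDerivWithinAt
  exact h.comp_hasDerivWithinAt (f := fun y => (y, t)) x
    ((hasDerivWithinAt_id x _).prodMk (hasDerivWithinAt_const x _ t)) fun y hy => ⟨hy, ht⟩

lemma hasDerivWithinAt_rect_snd {ℓ T : ℝ} {w : ℝ → ℝ → ℝ}
    (hw : ContDiffOn ℝ 1 (fun p : ℝ × ℝ => w p.1 p.2) (Icc 0 ℓ ×ˢ Icc 0 T))
    {x t : ℝ} (hx : x ∈ Icc 0 ℓ) (ht : t ∈ Icc 0 T) :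
    HasDerivWithinAt (fun τ => w x τ)
      (fderivWithin ℝ (fun p : ℝ × ℝ => w p.1 p.2) (Icc 0 ℓ ×ˢ Icc 0 T) (x, t) (0, 1))
      (Icc 0 T) t := by
  have h := ((hw.differentiableOn one_ne_zero) (x, t) ⟨hx, ht⟩).hasFDerivWithinAt
  exact h.comp_hasDerivWithinAt (f := fun τ => (x, τ)) t
    ((hasDerivWithinAt_const t _ x).prodMk (hasDerivWithinAt_id t _)) fun y hy => ⟨hx, hy⟩

/-- A function that is C¹ on a rectangle extends to a continuous function on the plane which has
a jointly continuous derivative in the second variable. -/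
lemma exists_extension_rect {ℓ T : ℝ} (hℓ : 0 < ℓ) (hT : 0 < T) {f : ℝ → ℝ → ℝ}
    (hf : ContDiffOn ℝ 1 (fun p : ℝ × ℝ => f p.1 p.2) (Icc 0 ℓ ×ˢ Icc 0 T)) :
    ∃ F K : ℝ → ℝ → ℝ, Continuous (fun p : ℝ × ℝ => F p.1 p.2) ∧
      Continuous (fun p : ℝ × ℝ => K p.1 p.2) ∧
      (∀ s t, HasDerivAt (F s) (K s t) t) ∧
      ∀ x ∈ Icc 0 ℓ, ∀ t ∈ Icc 0 T, F x t = f x t := by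
  set f' := fderivWithin ℝ (fun p : ℝ × ℝ => f p.1 p.2) (Icc 0 ℓ ×ˢ Icc 0 T) with hf'
  let K : ℝ → ℝ → ℝ := fun s t => f' (clampIcc ℓ s, clampIcc T t) (0, 1)
  have hcl : Continuous (clampIcc ℓ) := continuous_clampIcc ℓ
  have hcT : Continuous (clampIcc T) := continuous_clampIcc T
  have hK : Continuous (fun p : ℝ × ℝ => K p.1 p.2) := by
    have h1 : ContinuousOn f' (Icc 0 ℓ ×ˢ Icc 0 T) :=
      hf.continuousOn_fderivWithin (uniqueDiffOn_rect hℓ hT) le_rfl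
    have h2 : Continuous fun p : ℝ × ℝ => f' (clampIcc ℓ p.1, clampIcc T p.2) :=
      h1.comp_continuous (by fun_prop)
        fun p => ⟨clampIcc_mem hℓ.le _, clampIcc_mem hT.le _⟩
    exact h2.clm_apply continuous_const
  have hKs : ∀ s, Continuous (K s) := fun s =>
    hK.comp (Continuous.prodMk continuous_const continuous_id)
  refine ⟨fun s t => f (clampIcc ℓ s) 0 + ∫ τ in (0 : ℝ)..t, K s τ, K, ?_, hK, ?_, ?_⟩
  · refine Continuous.add ?_ ?_
    · exact hf.continuousOn.comp_continuous (f := fun p : ℝ × ℝ => (clampIcc ℓ p.1, (0 : ℝ)))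
        (by fun_prop) fun p => ⟨clampIcc_mem hℓ.le _, le_rfl, hT.le⟩
    · refine intervalIntegral.continuous_parametric_intervalIntegral_of_continuous
        (f := fun (p : ℝ × ℝ) τ => K p.1 τ) ?_ continuous_snd
      exact hK.comp (f := fun q : (ℝ × ℝ) × ℝ => (q.1.1, q.2)) (by fun_prop)
  · intro s t
    exact ((hKs s).integral_hasStrictDerivAt 0 t).hasDerivAt.const_add _
  · intro x hx t ht
    have hsub : Icc 0 t ⊆ Icc 0 T := Icc_subset_Icc_right ht.2
    have : ∫ τ in (0 : ℝ)..t, K x τ = f x t - f x 0 := by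
      refine intervalIntegral.integral_eq_sub_of_hasDerivAt_of_le ht.1 ?_ ?_
        ((hKs x).intervalIntegrable _ _)
      · intro τ hτ
        exact ((hasDerivWithinAt_rect_snd hf hx (hsub hτ)).continuousWithinAt).mono hsub
      · intro τ hτ
        have hτ' : τ ∈ Icc 0 T := hsub (Ioo_subset_Icc_self hτ)
        have := (hasDerivWithinAt_rect_snd hf hx hτ').hasDerivAt
          (Icc_mem_nhds hτ.1 (hτ.2.trans_le ht.2))
        simpa [K, hf', clampIcc_of_mem hx, clampIcc_of_mem hτ', -Icc_prod_Icc] using this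
    simp [this, clampIcc_of_mem hx]

/-- The integral of a source along characteristics of unit speed is C¹. -/
lemma contDiff_integral_characteristic {g k : ℝ → ℝ → ℝ}
    (hg : Continuous (fun p : ℝ × ℝ => g p.1 p.2))
    (hk : Continuous (fun p : ℝ × ℝ => k p.1 p.2))
    (hgk : ∀ s t, HasDerivAt (g s) (k s t) t) :
    ContDiff ℝ 1 (fun p : ℝ × ℝ => ∫ s in (0 : ℝ)..p.1, g s (p.2 + s)) := by
  have hg' : ∀ r, Continuous fun s => g s (r + s) := fun r =>
    hg.comp (f := fun s => (s, r + s)) (by fun_prop)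
  have hk' : Continuous fun q : ℝ × ℝ => k q.2 (q.1 + q.2) :=
    hk.comp (f := fun q : ℝ × ℝ => (q.2, q.1 + q.2)) (by fun_prop)
  let P : ℝ → ℝ → ℝ := fun y r => ∫ s in (0 : ℝ)..y, g s (r + s)
  let Q : ℝ → ℝ → ℝ := fun y r => ∫ s in (0 : ℝ)..y, k s (r + s)
  have hQ : Continuous (fun p : ℝ × ℝ => Q p.1 p.2) := by
    refine intervalIntegral.continuous_parametric_intervalIntegral_of_continuous
      (f := fun (p : ℝ × ℝ) s => k s (p.2 + s)) ?_ continuous_fst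
    exact hk.comp (f := fun q : (ℝ × ℝ) × ℝ => (q.2, q.1.2 + q.2)) (by fun_prop)
  have hPy : ∀ y r, HasDerivAt (fun y => P y r) (g y (r + y)) y := fun y r =>
    ((hg' r).integral_hasStrictDerivAt 0 y).hasDerivAt
  have hPr : ∀ y r, HasDerivAt (fun r => P y r) (Q y r) r := by
    intro y r
    obtain ⟨C, hC⟩ := ((isCompact_closedBall r 1).prod (isCompact_uIcc (a := 0) (b := y))
      ).exists_bound_of_continuousOn hk'.continuousOn
    refine (intervalIntegral.hasDerivAt_integral_of_dominated_loc_of_deriv_le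
      (F := fun r s => g s (r + s)) (F' := fun r s => k s (r + s)) (bound := fun _ => C)
      (Metric.closedBall_mem_nhds r one_pos) ?_ ((hg' r).intervalIntegrable _ _) ?_ ?_ ?_ ?_).2
    · exact Filter.Eventually.of_forall fun r => (hg' r).aestronglyMeasurable
    · exact (hk'.comp (f := fun s => (r, s)) (by fun_prop)).aestronglyMeasurable
    · exact Filter.Eventually.of_forall fun s hs r' hr' =>
        hC (r', s) ⟨hr', uIoc_subset_uIcc hs⟩
    · exact intervalIntegrable_const
    · exact Filter.Eventually.of_forall fun s _ r' _ => by
        simpa using (hgk s (r' + s)).comp_add_const r' s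
  rw [contDiff_one_iff_hasFDerivAt]
  let A : ℝ × ℝ → ℝ →L[ℝ] ℝ := fun p => ContinuousLinearMap.toSpanSingleton ℝ (g p.1 (p.2 + p.1))
  let B : ℝ × ℝ → ℝ →L[ℝ] ℝ := fun p => ContinuousLinearMap.toSpanSingleton ℝ (Q p.1 p.2)
  have hA : Continuous A := by
    refine (ContinuousLinearMap.toSpanSingletonCLE (𝕜 := ℝ)).continuous.comp ?_
    exact hg.comp (f := fun p : ℝ × ℝ => (p.1, p.2 + p.1)) (by fun_prop)
  have hB : Continuous B := (ContinuousLinearMap.toSpanSingletonCLE (𝕜 := ℝ)).continuous.comp hQ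
  refine ⟨fun p => (A p).coprod (B p), ?_, fun p => ?_⟩
  · change Continuous fun p => (A p).comp (ContinuousLinearMap.fst ℝ ℝ ℝ) +
      (B p).comp (ContinuousLinearMap.snd ℝ ℝ ℝ)
    exact (hA.clm_comp continuous_const).add (hB.clm_comp continuous_const)
  · exact (hasStrictFDerivAt_uncurry_coprod (u := p) (f := P) (f₁ := fun a b => A (a, b))
      (f₂ := fun a b => B (a, b))
      (Filter.Eventually.of_forall fun q => (hPy q.1 q.2).hasFDerivAt)
      (Filter.Eventually.of_forall fun q => (hPr q.1 q.2).hasFDerivAt)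
      hA.continuousAt hB.continuousAt).hasFDerivAt

/-- Solvability of `∂ₜ u + ∂_y u = g` with zero initial data and boundary data `b`. -/
lemma exists_unit_speed_solution {T : ℝ} (hT : 0 < T) {g k : ℝ → ℝ → ℝ}
    (hg : Continuous (fun p : ℝ × ℝ => g p.1 p.2))
    (hk : Continuous (fun p : ℝ × ℝ => k p.1 p.2))
    (hgk : ∀ s t, HasDerivAt (g s) (k s t) t) (hg0 : g 0 0 = 0)
    {b : ℝ → ℝ} (hb : ContDiffOn ℝ 1 b (Icc 0 T)) (hb0 : b 0 = 0)
    (hb'0 : derivWithin b (Icc 0 T) 0 = 0) :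
    ∃ u : ℝ → ℝ → ℝ, ContDiff ℝ 1 (fun p : ℝ × ℝ => u p.1 p.2) ∧
      (∀ y t, fderiv ℝ (fun p : ℝ × ℝ => u p.1 p.2) (y, t) (1, 1) = g y t) ∧
      (∀ y, 0 ≤ y → u y 0 = 0) ∧ ∀ t ∈ Icc 0 T, u 0 t = b t := by
  let P : ℝ × ℝ → ℝ := fun p => ∫ s in (0 : ℝ)..p.1, g s (p.2 + s)
  have hP : ContDiff ℝ 1 P := contDiff_integral_characteristic hg hk hgk
  have hPy : ∀ y r, HasDerivAt (fun y => P (y, r)) (g y (r + y)) y := fun y r =>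
    ((hg.comp (f := fun s => (s, r + s)) (by fun_prop)).integral_hasStrictDerivAt 0 y).hasDerivAt
  have hP0 : ∀ r, P (0, r) = 0 := fun r => by simp [P]
  have hPd : Differentiable ℝ P := hP.differentiable one_ne_zero
  let ψ : ℝ → ℝ := fun r => -P (-r, r)
  have hψ : ContDiff ℝ 1 ψ := by fun_prop
  have hψ'0 : deriv ψ 0 = 0 := by
    have h1 : fderiv ℝ P (0, 0) (1, 0) = 0 := by
      have h := (hPd (0, 0)).hasFDerivAt.comp_hasDerivAt (f := fun y : ℝ => (y, (0 : ℝ))) 0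
        ((hasDerivAt_id (0 : ℝ)).prodMk (hasDerivAt_const (0 : ℝ) (0 : ℝ)))
      simpa [hg0] using h.unique (hPy 0 0)
    have h2 : fderiv ℝ P (0, 0) (0, 1) = 0 := by
      have h := (hPd (0, 0)).hasFDerivAt.comp_hasDerivAt (f := fun r : ℝ => ((0 : ℝ), r)) 0
        ((hasDerivAt_const (0 : ℝ) (0 : ℝ)).prodMk (hasDerivAt_id (0 : ℝ)))
      have h0 : P ∘ (fun r : ℝ => ((0 : ℝ), r)) = fun _ => 0 := funext hP0
      rw [h0] at h
      exact h.unique (hasDerivAt_const _ _)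
    have h3 : HasFDerivAt P (fderiv ℝ P (0, 0)) (-(0 : ℝ), (0 : ℝ)) := by
      simpa using (hPd (0, 0)).hasFDerivAt
    have h := (h3.comp_hasDerivAt (f := fun r : ℝ => (-r, r)) 0
      ((hasDerivAt_id (0 : ℝ)).neg.prodMk (hasDerivAt_id (0 : ℝ)))).neg
    have h4 : ((-1 : ℝ), (1 : ℝ)) = (-1 : ℝ) • ((1 : ℝ), (0 : ℝ)) + ((0 : ℝ), (1 : ℝ)) := by simp
    rw [h4, map_add, map_smul, h1, h2] at h
    exact h.deriv.trans (by simp)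
  have hψ' : Continuous (deriv ψ) := hψ.continuous_deriv le_rfl
  have hb' : ContinuousOn (derivWithin b (Icc 0 T)) (Icc 0 T) :=
    hb.continuousOn_derivWithin (uniqueDiffOn_Icc hT) le_rfl
  let c : ℝ → ℝ := fun r => derivWithin b (Icc 0 T) (clampIcc T r) + deriv ψ (min r 0)
  have hc : Continuous c := by
    refine Continuous.add ?_ (hψ'.comp (by fun_prop))
    exact hb'.comp_continuous (continuous_clampIcc T) fun r => clampIcc_mem hT.le r
  let φ : ℝ → ℝ := fun r => ∫ s in (0 : ℝ)..r, c s
  have hφd : ∀ r, HasDerivAt φ (c r) r := fun r => (hc.integral_hasStrictDerivAt 0 r).hasDerivAt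
  have hφ : ContDiff ℝ 1 φ := by
    rw [contDiff_one_iff_deriv]
    refine ⟨fun r => (hφd r).differentiableAt, ?_⟩
    rwa [show deriv φ = c from funext fun r => (hφd r).deriv]
  have hφb : ∀ t ∈ Icc 0 T, φ t = b t := by
    intro t ht
    have : ∫ s in (0 : ℝ)..t, c s = b t - b 0 := by
      refine intervalIntegral.integral_eq_sub_of_hasDerivAt_of_le ht.1
        (hb.continuousOn.mono (Icc_subset_Icc_right ht.2)) ?_ (hc.intervalIntegrable _ _)
      intro s hs
      have hs' : s ∈ Icc 0 T := ⟨hs.1.le, hs.2.le.trans ht.2⟩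
      have hd := ((hb.differentiableOn one_ne_zero) s hs').hasDerivWithinAt.hasDerivAt
        (Icc_mem_nhds hs.1 (hs.2.trans_le ht.2))
      simpa [c, clampIcc_of_mem hs', min_eq_right hs.1.le, hψ'0] using hd
    simpa [φ, hb0] using this
  have hφψ : ∀ r ≤ 0, φ r = ψ r := by
    intro r hr
    have h1 : ∫ s in (0 : ℝ)..r, c s = ∫ s in (0 : ℝ)..r, deriv ψ s := by
      refine intervalIntegral.integral_congr fun s hs => ?_
      rw [uIcc_of_ge hr] at hs
      simp [c, clampIcc_of_nonpos hT.le hs.2, hb'0, min_eq_left hs.2]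
    have h2 : ∫ s in (0 : ℝ)..r, deriv ψ s = ψ r - ψ 0 :=
      intervalIntegral.integral_deriv_eq_sub
        (fun s _ => (hψ.differentiable one_ne_zero) s) (hψ'.intervalIntegrable _ _)
    have h3 : ψ 0 = 0 := by simp [ψ, hP0]
    simp only [φ, h1, h2, h3, sub_zero]
  have hu : ContDiff ℝ 1 (fun p : ℝ × ℝ => φ (p.2 - p.1) + P (p.1, p.2 - p.1)) := by fun_prop
  refine ⟨fun y t => φ (t - y) + P (y, t - y), hu, ?_, ?_, ?_⟩
  · intro y t
    have h3 : HasFDerivAt (fun p : ℝ × ℝ => φ (p.2 - p.1) + P (p.1, p.2 - p.1)) _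
      (y, t - y + y) := (hu.differentiable one_ne_zero _).hasFDerivAt
    have h := h3.comp_hasDerivAt (f := fun s : ℝ => (s, t - y + s)) y
      ((hasDerivAt_id y).prodMk ((hasDerivAt_id y).const_add (t - y)))
    have h' : HasDerivAt (fun s => φ (t - y) + P (s, t - y)) (g y (t - y + y)) y :=
      (hPy y (t - y)).const_add _
    have he : (fun p : ℝ × ℝ => φ (p.2 - p.1) + P (p.1, p.2 - p.1)) ∘
      (fun s : ℝ => (s, t - y + s)) = fun s => φ (t - y) + P (s, t - y) := by
      funext s; simp
    rw [he] at h
    simpa using h.unique h'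
  · intro y hy
    simp [hφψ (-y) (by linarith), ψ]
  · intro t ht
    simp [hφb t ht, hP0]

/-- The travel time along an edge and its inverse, both defined on the whole line. -/
lemma exists_travelTime {ℓ : ℝ} (hℓ : 0 < ℓ) {v : ℝ → ℝ} (hv : ContinuousOn v (Icc 0 ℓ))
    (hpos : ∀ x ∈ Icc 0 ℓ, 0 < v x) :
    ∃ Y X : ℝ → ℝ, ContDiff ℝ 1 Y ∧ Continuous X ∧ StrictMono Y ∧ Y 0 = 0 ∧
      (∀ x, X (Y x) = x) ∧ ∀ x ∈ Icc 0 ℓ, HasDerivAt Y (v x)⁻¹ x := by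
  let q : ℝ → ℝ := fun x => (v (clampIcc ℓ x))⁻¹
  have hvc : Continuous fun x => v (clampIcc ℓ x) :=
    hv.comp_continuous (continuous_clampIcc ℓ) fun x => clampIcc_mem hℓ.le x
  have hvpos : ∀ x, 0 < v (clampIcc ℓ x) := fun x => hpos _ (clampIcc_mem hℓ.le x)
  have hq : Continuous q := hvc.inv₀ fun x => (hvpos x).ne'
  let Y : ℝ → ℝ := fun x => ∫ s in (0 : ℝ)..x, q s
  have hYd : ∀ x, HasDerivAt Y (q x) x := fun x => (hq.integral_hasStrictDerivAt 0 x).hasDerivAt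
  have hY0 : Y 0 = 0 := by simp [Y]
  have hY : ContDiff ℝ 1 Y := by
    rw [contDiff_one_iff_deriv]
    refine ⟨fun r => (hYd r).differentiableAt, ?_⟩
    rwa [show deriv Y = q from funext fun r => (hYd r).deriv]
  have hmono : StrictMono Y := strictMono_of_deriv_pos fun x => by
    rw [(hYd x).deriv]; exact inv_pos.2 (hvpos x)
  obtain ⟨M, hM⟩ := isCompact_Icc.exists_bound_of_continuousOn hv
  have hMpos : 0 < M := (hvpos 0).trans_le
    ((le_abs_self _).trans (hM _ (clampIcc_mem hℓ.le 0)))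
  have hqM : ∀ x, M⁻¹ ≤ q x := fun x => inv_anti₀ (hvpos x)
    ((le_abs_self _).trans (hM _ (clampIcc_mem hℓ.le x)))
  have hmono' : Monotone fun x => Y x - M⁻¹ * x := by
    have hd : ∀ x, HasDerivAt (fun x => Y x - M⁻¹ * x) (q x - M⁻¹) x := fun x => by
      exact ((hYd x).sub ((hasDerivAt_id x).const_mul M⁻¹)).congr_deriv (by simp)
    refine monotone_of_deriv_nonneg (fun x => (hd x).differentiableAt) fun x => ?_
    rw [(hd x).deriv]; linarith [hqM x]
  have hlin : Filter.Tendsto (fun x : ℝ => M⁻¹ * x) Filter.atTop Filter.atTop :=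
    Filter.tendsto_id.const_mul_atTop (inv_pos.2 hMpos)
  have hlin' : Filter.Tendsto (fun x : ℝ => M⁻¹ * x) Filter.atBot Filter.atBot :=
    Filter.tendsto_id.const_mul_atBot (inv_pos.2 hMpos)
  have hsurj : Function.Surjective Y := by
    refine hY.continuous.surjective ?_ ?_
    · refine Filter.tendsto_atTop_mono' _ ?_ hlin
      filter_upwards [Filter.eventually_ge_atTop 0] with x hx
      have := hmono' hx
      simp only [hY0] at this; linarith
    · refine Filter.tendsto_atBot_mono' _ ?_ hlin'
      filter_upwards [Filter.eventually_le_atBot 0] with x hx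
      have := hmono' hx
      simp only [hY0] at this; linarith
  let e : ℝ ≃o ℝ := hmono.orderIsoOfSurjective Y hsurj
  refine ⟨Y, e.symm, hY, e.symm.continuous, hmono, hY0, fun x => e.symm_apply_apply x, ?_⟩
  intro x hx
  simpa [q, clampIcc_of_mem hx] using hYd x

/-- Existence on a single edge with inflow at `x = 0`. -/
lemma EdgeSol.exists_of_pos {ℓ T : ℝ} (hℓ : 0 < ℓ) (hT : 0 < T) {v : ℝ → ℝ}
    (hv : ContDiffOn ℝ 1 v (Icc 0 ℓ)) (hpos : ∀ x ∈ Icc 0 ℓ, 0 < v x) {f : ℝ → ℝ → ℝ}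
    (hf : ContDiffOn ℝ 1 (fun p : ℝ × ℝ => f p.1 p.2) (Icc 0 ℓ ×ˢ Icc 0 T))
    (hf0 : f 0 0 = 0) {b : ℝ → ℝ} (hb : ContDiffOn ℝ 1 b (Icc 0 T)) (hb0 : b 0 = 0)
    (hb'0 : derivWithin b (Icc 0 T) 0 = 0) :
    ∃ w : ℝ → ℝ → ℝ, EdgeSol ℓ T v f w ∧ ∀ t ∈ Icc 0 T, w 0 t = b t := by
  obtain ⟨F, K, hF, hK, hFK, hFf⟩ := exists_extension_rect hℓ hT hf
  obtain ⟨Y, X, hY, hX, hmono, hY0, hXY, hYd⟩ := exists_travelTime hℓ hv.continuousOn hpos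
  have h0ℓ : (0 : ℝ) ∈ Icc 0 ℓ := ⟨le_rfl, hℓ.le⟩
  have h0T : (0 : ℝ) ∈ Icc 0 T := ⟨le_rfl, hT.le⟩
  have hvc : Continuous fun y => v (clampIcc ℓ (X y)) :=
    hv.continuousOn.comp_continuous ((continuous_clampIcc ℓ).comp hX)
      fun y => clampIcc_mem hℓ.le _
  have hv0 : v 0 ≠ 0 := (hpos 0 h0ℓ).ne'
  have hX0 : X 0 = 0 := by simpa [hY0] using hXY 0
  obtain ⟨u, hu, hug, hu0, hub⟩ := exists_unit_speed_solution hT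
    (g := fun y t => v (clampIcc ℓ (X y)) * F (X y) t)
    (k := fun y t => v (clampIcc ℓ (X y)) * K (X y) t)
    ((hvc.comp continuous_fst).mul
      (hF.comp (f := fun p : ℝ × ℝ => (X p.1, p.2)) (by fun_prop)))
    ((hvc.comp continuous_fst).mul
      (hK.comp (f := fun p : ℝ × ℝ => (X p.1, p.2)) (by fun_prop)))
    (fun y t => (hFK (X y) t).const_mul _)
    (by simp [hX0, hFf 0 h0ℓ 0 h0T, hf0])
    (b := fun t => v 0 * b t) (contDiffOn_const.mul hb) (by simp [hb0])
    (by simp [derivWithin_const_mul_field, hb'0])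
  have hud : Differentiable ℝ (fun p : ℝ × ℝ => u p.1 p.2) := hu.differentiable one_ne_zero
  have hw : ContDiffOn ℝ 1 (fun p : ℝ × ℝ => u (Y p.1) p.2 / v p.1) (Icc 0 ℓ ×ˢ Icc 0 T) := by
    refine ContDiffOn.div ?_ ?_ fun p hp => (hpos _ hp.1).ne'
    · exact (hu.comp (f := fun p : ℝ × ℝ => (Y p.1, p.2)) (by fun_prop)).contDiffOn
    · exact hv.comp contDiffOn_fst fun p hp => hp.1
  refine ⟨fun x t => u (Y x) t / v x, ⟨hw, ?_, ?_⟩, ?_⟩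
  · intro x hx t ht
    have hvx : v x ≠ 0 := (hpos x hx).ne'
    have hfd := (hud (Y x, t)).hasFDerivAt
    have h1 := hfd.comp_hasDerivAt (f := fun τ : ℝ => (Y x, τ)) t
      ((hasDerivAt_const t (Y x)).prodMk (hasDerivAt_id t))
    have h2 := hfd.comp_hasDerivAt (f := fun z : ℝ => (Y z, t)) x
      ((hYd x hx).prodMk (hasDerivAt_const x t))
    have hxu := uniqueDiffOn_Icc hℓ x hx
    have hτ : derivWithin (fun τ => u (Y x) τ / v x) (Icc 0 T) t =
        fderiv ℝ (fun p : ℝ × ℝ => u p.1 p.2) (Y x, t) (0, 1) / v x :=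
      (h1.div_const (v x)).hasDerivWithinAt.derivWithin (uniqueDiffOn_Icc hT t ht)
    have hwx := (hasDerivWithinAt_rect_fst (w := fun x t => u (Y x) t / v x) hw hx ht
      ).differentiableWithinAt
    have hy : derivWithin v (Icc 0 ℓ) x * (u (Y x) t / v x) +
        v x * derivWithin (fun z => u (Y z) t / v z) (Icc 0 ℓ) x =
        fderiv ℝ (fun p : ℝ × ℝ => u p.1 p.2) (Y x, t) ((v x)⁻¹, 0) := by
      have hvd := (hv.differentiableOn one_ne_zero x hx).hasDerivWithinAt
      have hmul : ∀ z ∈ Icc 0 ℓ, u (Y z) t = v z * (u (Y z) t / v z) := fun z hz =>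
        (mul_div_cancel₀ _ (hpos z hz).ne').symm
      exact hxu.eq_deriv _ ((hvd.mul hwx.hasDerivWithinAt).congr hmul (hmul x hx))
        h2.hasDerivWithinAt
    have hsum : ((v x)⁻¹, (0 : ℝ)) = (v x)⁻¹ • ((1 : ℝ), (0 : ℝ)) := by simp
    have h11 : ((1 : ℝ), (1 : ℝ)) = (1, 0) + (0, 1) := by simp
    have hgu := hug (Y x) t
    rw [h11, map_add, hXY, clampIcc_of_mem hx, hFf x hx t ht] at hgu
    rw [hτ, hy, hsum, map_smul, smul_eq_mul]
    field_simp
    linarith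
  · intro x hx
    simp [hu0 (Y x) (hY0 ▸ hmono.monotone hx.1)]
  · intro t ht
    simp [hY0, hub t ht, hv0]

/-- Uniqueness on a single edge with inflow at `x = 0`. -/
lemma EdgeSol.eq_of_pos {ℓ T : ℝ} (hℓ : 0 < ℓ) (hT : 0 < T) {v : ℝ → ℝ}
    (hv : ContDiffOn ℝ 1 v (Icc 0 ℓ)) (hpos : ∀ x ∈ Icc 0 ℓ, 0 < v x) {f w w' : ℝ → ℝ → ℝ}
    (hw : EdgeSol ℓ T v f w) (hw' : EdgeSol ℓ T v f w')
    (hb : ∀ t ∈ Icc 0 T, w 0 t = w' 0 t) :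
    ∀ x ∈ Icc 0 ℓ, ∀ t ∈ Icc 0 T, w x t = w' x t := by
  obtain ⟨Y, -, hY, -, hmono, hY0, -, hYd⟩ := exists_travelTime hℓ hv.continuousOn hpos
  intro x hx t ht
  obtain ⟨a, ha, haT, hzero⟩ : ∃ a ∈ Icc 0 x, 0 ≤ t - Y x + Y a ∧
      w a (t - Y x + Y a) = w' a (t - Y x + Y a) := by
    have hYx : 0 ≤ Y x := hY0 ▸ hmono.monotone hx.1
    rcases le_total (Y x) t with h | h
    · refine ⟨0, ⟨le_rfl, hx.1⟩, by linarith, hb _ ⟨by linarith, by linarith [ht.2]⟩⟩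
    · obtain ⟨a, ha, hYa⟩ := intermediate_value_Icc hx.1 hY.continuous.continuousOn
        (show Y x - t ∈ Icc (Y 0) (Y x) from ⟨by linarith, by linarith [ht.1]⟩)
      have h0 : t - Y x + Y a = 0 := by linarith
      have haℓ : a ∈ Icc 0 ℓ := ⟨ha.1, ha.2.trans hx.2⟩
      exact ⟨a, ha, h0.ge, by rw [h0, hw.2.2 a haℓ, hw'.2.2 a haℓ]⟩
  have hsub : Icc a x ⊆ Icc 0 ℓ := Icc_subset_Icc ha.1 hx.2
  have hmaps : ∀ y ∈ Icc a x, t - Y x + Y y ∈ Icc 0 T := fun y hy =>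
    ⟨by linarith [hmono.monotone hy.1], by linarith [hmono.monotone hy.2, ht.2]⟩
  have key : ∀ z, EdgeSol ℓ T v f z → ∀ y ∈ Icc a x,
      HasDerivWithinAt (fun y => v y * z y (t - Y x + Y y)) (f y (t - Y x + Y y)) (Icc a x) y := by
    intro z hz y hy
    have hyℓ := hsub hy
    have hyT := hmaps y hy
    have hfd := ((hz.1.differentiableOn one_ne_zero) (y, t - Y x + Y y) ⟨hyℓ, hyT⟩
      ).hasFDerivWithinAt
    have hcomp := hfd.comp_hasDerivWithinAt (f := fun y => (y, t - Y x + Y y)) y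
      ((hasDerivWithinAt_id y (Icc a x)).prodMk
        ((hYd y hyℓ).hasDerivWithinAt.const_add (t - Y x)))
      fun s hs => ⟨hsub hs, hmaps s hs⟩
    have hvd := (hv.differentiableOn one_ne_zero y hyℓ).hasDerivWithinAt.mono hsub
    refine (hvd.mul hcomp).congr_deriv ?_
    have hpde := hz.2.1 y hyℓ _ hyT
    rw [(hasDerivWithinAt_rect_fst hz.1 hyℓ hyT).derivWithin (uniqueDiffOn_Icc hℓ y hyℓ),
      (hasDerivWithinAt_rect_snd hz.1 hyℓ hyT).derivWithin (uniqueDiffOn_Icc hT _ hyT)] at hpde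
    have hdir : ((1 : ℝ), (v y)⁻¹) = (1, 0) + (v y)⁻¹ • ((0 : ℝ), (1 : ℝ)) := by simp
    rw [hdir, map_add, map_smul, smul_eq_mul, mul_add, mul_inv_cancel_left₀ (hpos y hyℓ).ne',
      ← hpde]
    simp only [Function.comp_apply]
    ring
  have hconst := constant_of_has_deriv_right_zero
    (f := fun y => v y * w y (t - Y x + Y y) - v y * w' y (t - Y x + Y y)) (a := a) (b := x)
    (fun y hy => ((key w hw y hy).sub (key w' hw' y hy)).continuousWithinAt)
    (fun y hy => by
      have := (key w hw y (Ico_subset_Icc_self hy)).sub (key w' hw' y (Ico_subset_Icc_self hy))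
      rw [sub_self] at this
      exact this.mono_of_mem_nhdsWithin (Icc_mem_nhdsGE_of_mem hy)) x ⟨ha.2, le_rfl⟩
  simp only [hzero, sub_self, sub_add_cancel, ← mul_sub] at hconst
  exact sub_eq_zero.1 ((mul_eq_zero.1 (by simpa using hconst)).resolve_left (hpos x hx).ne')

open Pointwise in
lemma derivWithin_reflect {ℓ : ℝ} (g : ℝ → ℝ) (x : ℝ) :
    derivWithin (fun y => g (ℓ - y)) (Icc 0 ℓ) x = -derivWithin g (Icc 0 ℓ) (ℓ - x) := by
  have hs : ℓ +ᵥ -Icc 0 ℓ = Icc 0 ℓ := by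
    ext y
    simp [and_comm]
  rw [derivWithin_comp_const_sub, hs]

lemma reflect_mem_Icc {ℓ x : ℝ} (hx : x ∈ Icc 0 ℓ) : ℓ - x ∈ Icc 0 ℓ :=
  ⟨by linarith [hx.2], by linarith [hx.1]⟩

lemma contDiffOn_reflect {ℓ : ℝ} {g : ℝ → ℝ} (hg : ContDiffOn ℝ 1 g (Icc 0 ℓ)) :
    ContDiffOn ℝ 1 (fun x => g (ℓ - x)) (Icc 0 ℓ) :=
  hg.comp (f := fun x => ℓ - x) (by fun_prop) fun _ hx => reflect_mem_Icc hx

lemma contDiffOn_rect_reflect {ℓ T : ℝ} {g : ℝ → ℝ → ℝ}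
    (hg : ContDiffOn ℝ 1 (fun p : ℝ × ℝ => g p.1 p.2) (Icc 0 ℓ ×ˢ Icc 0 T)) :
    ContDiffOn ℝ 1 (fun p : ℝ × ℝ => g (ℓ - p.1) p.2) (Icc 0 ℓ ×ˢ Icc 0 T) :=
  hg.comp (f := fun p : ℝ × ℝ => (ℓ - p.1, p.2)) (by fun_prop)
    fun _ hp => ⟨reflect_mem_Icc hp.1, hp.2⟩

/-- Reversing the orientation of an edge preserves solutions. -/
lemma EdgeSol.reflect {ℓ T : ℝ} {v : ℝ → ℝ} {f w : ℝ → ℝ → ℝ} (h : EdgeSol ℓ T v f w) :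
    EdgeSol ℓ T (fun x => -v (ℓ - x)) (fun x t => f (ℓ - x) t) (fun x t => w (ℓ - x) t) := by
  refine ⟨contDiffOn_rect_reflect h.1, fun x hx t ht => ?_,
    fun x hx => h.2.2 _ (reflect_mem_Icc hx)⟩
  beta_reduce
  rw [← h.2.1 _ (reflect_mem_Icc hx) t ht, derivWithin_reflect (fun y => w y t),
    derivWithin.fun_neg, derivWithin_reflect v]
  ring

/-- Time derivative at the origin of a solution on an edge with compatible source. -/
lemma EdgeSol.derivWithin_zero {ℓ T : ℝ} (hℓ : 0 < ℓ) (hT : 0 < T) {v : ℝ → ℝ}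
    {f w : ℝ → ℝ → ℝ} (h : EdgeSol ℓ T v f w) (hf0 : f 0 0 = 0) :
    derivWithin (fun t => w 0 t) (Icc 0 T) 0 = 0 := by
  have h0ℓ : (0 : ℝ) ∈ Icc 0 ℓ := ⟨le_rfl, hℓ.le⟩
  have hpde := h.2.1 0 h0ℓ 0 ⟨le_rfl, hT.le⟩
  have hx : derivWithin (fun y => w y 0) (Icc 0 ℓ) 0 = 0 := by
    rw [derivWithin_congr (f := fun _ => (0 : ℝ)) (fun y hy => h.2.2 y hy) (h.2.2 0 h0ℓ)]
    simp
  simpa [hx, h.2.2 0 h0ℓ, hf0] using hpde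

/-- Unique classical solvability of problem (3.30) with the weighted-average vertex
conditions (3.31), together with the inhomogeneous Kirchhoff condition with datum `d`. -/
theorem graph_transport_weighted_wellposed
    (T : ℝ) (hT : 0 < T)
    (ℓ₁ ℓ₂ ℓ₃ : ℝ) (hℓ₁ : 1 ≤ ℓ₁) (hℓ₂ : 1 ≤ ℓ₂) (hℓ₃ : 1 ≤ ℓ₃)
    (h₁ h₂ h₃ : ℝ) (hh₁ : 0 < h₁) (hh₂ : 0 < h₂) (hh₃ : 0 < h₃)
    (v₁ v₂ v₃ : ℝ → ℝ)
    (hv₁ : ContDiffOn ℝ 1 v₁ (Icc 0 ℓ₁))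
    (hv₂ : ContDiffOn ℝ 1 v₂ (Icc 0 ℓ₂))
    (hv₃ : ContDiffOn ℝ 1 v₃ (Icc 0 ℓ₃))
    (hv₁neg : ∀ x ∈ Icc 0 ℓ₁, v₁ x < 0)
    (hv₂pos : ∀ x ∈ Icc 0 ℓ₂, 0 < v₂ x)
    (hv₃pos : ∀ x ∈ Icc 0 ℓ₃, 0 < v₃ x)
    (f₁ f₂ f₃ : ℝ → ℝ → ℝ)
    (hf₁ : ContDiffOn ℝ 1 (fun p : ℝ × ℝ => f₁ p.1 p.2) (Icc 0 ℓ₁ ×ˢ Icc 0 T))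
    (hf₂ : ContDiffOn ℝ 1 (fun p : ℝ × ℝ => f₂ p.1 p.2) (Icc 0 ℓ₂ ×ˢ Icc 0 T))
    (hf₃ : ContDiffOn ℝ 1 (fun p : ℝ × ℝ => f₃ p.1 p.2) (Icc 0 ℓ₃ ×ˢ Icc 0 T))
    (hf₁ℓ : f₁ ℓ₁ 0 = 0)
    (hf₁0 : f₁ 0 0 = 0) (hf₂0 : f₂ 0 0 = 0) (hf₃0 : f₃ 0 0 = 0)
    (d : ℝ → ℝ) (hd : ContDiffOn ℝ 1 d (Icc 0 T))
    (hd0 : d 0 = 0) (hd'0 : derivWithin d (Icc 0 T) 0 = 0) :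
    ∃ w₁ w₂ w₃ : ℝ → ℝ → ℝ,
      GraphSolWeighted ℓ₁ ℓ₂ ℓ₃ T h₁ h₂ h₃ v₁ v₂ v₃ f₁ f₂ f₃ d w₁ w₂ w₃ ∧
      (∀ w₁' w₂' w₃' : ℝ → ℝ → ℝ,
        GraphSolWeighted ℓ₁ ℓ₂ ℓ₃ T h₁ h₂ h₃ v₁ v₂ v₃ f₁ f₂ f₃ d w₁' w₂' w₃' →
          (∀ x ∈ Icc 0 ℓ₁, ∀ t ∈ Icc 0 T, w₁' x t = w₁ x t) ∧
          (∀ x ∈ Icc 0 ℓ₂, ∀ t ∈ Icc 0 T, w₂' x t = w₂ x t) ∧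
          (∀ x ∈ Icc 0 ℓ₃, ∀ t ∈ Icc 0 T, w₃' x t = w₃ x t)) ∧
      (∀ t ∈ Icc 0 T,
        v₁ 0 * h₁ ^ 2 * w₁ 0 t + v₂ 0 * h₂ ^ 2 * w₂ 0 t + v₃ 0 * h₃ ^ 2 * w₃ 0 t = d t) := by
  have hp₁ : 0 < ℓ₁ := one_pos.trans_le hℓ₁
  have hp₂ : 0 < ℓ₂ := one_pos.trans_le hℓ₂
  have hp₃ : 0 < ℓ₃ := one_pos.trans_le hℓ₃
  have h0₁ : (0 : ℝ) ∈ Icc 0 ℓ₁ := ⟨le_rfl, hp₁.le⟩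
  have h0T : (0 : ℝ) ∈ Icc 0 T := ⟨le_rfl, hT.le⟩
  have hv₁' : ContDiffOn ℝ 1 (fun x => -v₁ (ℓ₁ - x)) (Icc 0 ℓ₁) := (contDiffOn_reflect hv₁).neg
  have hv₁pos : ∀ x ∈ Icc 0 ℓ₁, 0 < -v₁ (ℓ₁ - x) := fun x hx =>
    neg_pos.2 (hv₁neg _ (reflect_mem_Icc hx))
  obtain ⟨z, hz, hz0⟩ := EdgeSol.exists_of_pos hp₁ hT hv₁' hv₁pos
    (f := fun x t => f₁ (ℓ₁ - x) t) (contDiffOn_rect_reflect hf₁) (by simpa using hf₁ℓ) (b := fun _ => 0) contDiffOn_const rfl (by simp)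
  obtain ⟨w₁, hw₁, hw₁ℓ⟩ : ∃ w₁, EdgeSol ℓ₁ T v₁ f₁ w₁ ∧ ∀ t ∈ Icc 0 T, w₁ ℓ₁ t = 0 :=
    ⟨fun x t => z (ℓ₁ - x) t, by simpa using hz.reflect, by simpa using hz0⟩
  have hw₁0 : ContDiffOn ℝ 1 (fun t => w₁ 0 t) (Icc 0 T) :=
    hw₁.1.comp (f := fun t : ℝ => ((0 : ℝ), t)) (by fun_prop) fun t ht => ⟨h0₁, ht⟩
  let b : ℝ → ℝ → ℝ := fun c t => (d t - v₁ 0 * h₁ ^ 2 * w₁ 0 t) / c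
  have hb : ∀ c, ContDiffOn ℝ 1 (b c) (Icc 0 T) := fun c =>
    (hd.sub (contDiffOn_const.mul hw₁0)).div_const c
  have hb0 : ∀ c, b c 0 = 0 := fun c => by simp [b, hd0, hw₁.2.2 0 h0₁]
  have hb'0 : ∀ c, derivWithin (b c) (Icc 0 T) 0 = 0 := fun c => by
    have h1 := (hd.differentiableOn one_ne_zero 0 h0T).hasDerivWithinAt
    have h2 := (hw₁0.differentiableOn one_ne_zero 0 h0T).hasDerivWithinAt
    rw [hd'0] at h1
    rw [hw₁.derivWithin_zero hp₁ hT hf₁0] at h2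
    have h3 := ((h1.sub (h2.const_mul (v₁ 0 * h₁ ^ 2))).div_const c).derivWithin
      (uniqueDiffOn_Icc hT 0 h0T)
    exact h3.trans (by simp)
  obtain ⟨w₂, hw₂, hw₂0⟩ := EdgeSol.exists_of_pos hp₂ hT hv₂ hv₂pos hf₂ hf₂0
    (hb (2 * v₂ 0 * h₂ ^ 2)) (hb0 _) (hb'0 _)
  obtain ⟨w₃, hw₃, hw₃0⟩ := EdgeSol.exists_of_pos hp₃ hT hv₃ hv₃pos hf₃ hf₃0
    (hb (2 * v₃ 0 * h₃ ^ 2)) (hb0 _) (hb'0 _)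
  refine ⟨w₁, w₂, w₃, ⟨hw₁, hw₂, hw₃, hw₁ℓ, fun t ht => ⟨hw₂0 t ht, hw₃0 t ht⟩⟩, ?_, ?_⟩
  · rintro w₁' w₂' w₃' ⟨hw₁', hw₂', hw₃', hw₁ℓ', hv'⟩
    have hE₁ : ∀ x ∈ Icc 0 ℓ₁, ∀ t ∈ Icc 0 T, w₁' x t = w₁ x t := by
      intro x hx t ht
      simpa using EdgeSol.eq_of_pos hp₁ hT hv₁' hv₁pos hw₁'.reflect hw₁.reflect
        (fun t ht => by simp [hw₁ℓ t ht, hw₁ℓ' t ht]) (ℓ₁ - x) (reflect_mem_Icc hx) t ht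
    refine ⟨hE₁, ?_, ?_⟩
    · refine hw₂'.eq_of_pos hp₂ hT hv₂ hv₂pos hw₂ fun t ht => ?_
      rw [(hv' t ht).1, hw₂0 t ht, hE₁ 0 h0₁ t ht]
    · refine hw₃'.eq_of_pos hp₃ hT hv₃ hv₃pos hw₃ fun t ht => ?_
      rw [(hv' t ht).2, hw₃0 t ht, hE₁ 0 h0₁ t ht]
  · intro t ht
    have hn₂ : v₂ 0 ≠ 0 := (hv₂pos 0 ⟨le_rfl, hp₂.le⟩).ne'
    have hn₃ : v₃ 0 ≠ 0 := (hv₃pos 0 ⟨le_rfl, hp₃.le⟩).ne'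
    rw [hw₂0 t ht, hw₃0 t ht]
    simp only [b]
    field_simp
    ring
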